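/- Let ν ∈ ℝ and let Q be an admissible quantization of P of type (i)′ with parameter ν. Then Q(ℓ sin θ) = Q(sin θ)Q(ℓ) − (i/2)Q(cos θ) and Q(ℓ cos θ) = Q(cos θ)Q(ℓ) + (i/2)Q(sin θ) as linear operators on D. -/

import Mathlib

noncomputable section

open Complex

/-- Partial derivative in the first (angle) variable. -/
def pdTheta (f : ℝ × ℝ → ℝ) : ℝ × ℝ → ℝ := fun p => deriv (fun t => f (t, p.2)) p.1

/-- Partial derivative in the second (momentum) variable. -/
def pdEll (f : ℝ × ℝ → ℝ) : ℝ × ℝ → ℝ := fun p => deriv (fun l => f (p.1, l)) p.2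

/-- Poisson bracket `{f,g} = f_ℓ g_θ − f_θ g_ℓ`. -/
def pb (f g : ℝ × ℝ → ℝ) : ℝ × ℝ → ℝ :=
  fun p => pdEll f p * pdTheta g p - pdTheta f p * pdEll g p

/-- Spanning set for the polynomial algebra `P`. -/
def PGens : Set (ℝ × ℝ → ℝ) :=
  {h | ∃ r m : ℕ, h = (fun p : ℝ × ℝ => p.2 ^ r * Real.sin (m * p.1)) ∨
       h = (fun p : ℝ × ℝ => p.2 ^ r * Real.cos (m * p.1))}

/-- The polynomial algebra `P`. -/
def P : Submodule ℝ (ℝ × ℝ → ℝ) := Submodule.span ℝ PGens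

def fone : ℝ × ℝ → ℝ := fun _ => 1
def fell : ℝ × ℝ → ℝ := fun p => p.2
def fsin : ℝ × ℝ → ℝ := fun p => Real.sin p.1
def fcos : ℝ × ℝ → ℝ := fun p => Real.cos p.1

lemma fone_mem_P : fone ∈ P :=
  Submodule.subset_span ⟨0, 0, Or.inr (by funext p; simp [fone])⟩

lemma fell_mem_P : fell ∈ P :=
  Submodule.subset_span ⟨1, 0, Or.inr (by funext p; simp [fell])⟩

lemma fsin_mem_P : fsin ∈ P :=
  Submodule.subset_span ⟨0, 1, Or.inl (by funext p; simp [fsin])⟩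

lemma fcos_mem_P : fcos ∈ P :=
  Submodule.subset_span ⟨0, 1, Or.inr (by funext p; simp [fcos])⟩

/-- The domain `D = C^∞(S¹,ℂ)`: smooth `2π`-periodic functions. -/
def Dom : Submodule ℂ (ℝ → ℂ) where
  carrier := {ψ | ContDiff ℝ (⊤ : ℕ∞) ψ ∧ ∀ t, ψ (t + 2 * Real.pi) = ψ t}
  add_mem' := by
    intro a b ha hb
    exact ⟨ha.1.add hb.1, fun t => by simp [Pi.add_apply, ha.2 t, hb.2 t]⟩
  zero_mem' := ⟨contDiff_const, fun t => rfl⟩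
  smul_mem' := by
    intro c a ha
    exact ⟨ha.1.const_smul c, fun t => by simp [Pi.smul_apply, ha.2 t]⟩

/-- The `L²` inner product on `D`. -/
def ip (φ ψ : ℝ → ℂ) : ℂ := ∫ t in (0:ℝ)..(2 * Real.pi), (starRingEnd ℂ) (φ t) * ψ t

/-- Symmetric operator on `D`. -/
def SymmetricOp (A : Dom →ₗ[ℂ] Dom) : Prop :=
  ∀ φ ψ : Dom, ip (A φ : ℝ → ℂ) (ψ : ℝ → ℂ) = ip (φ : ℝ → ℂ) (A ψ : ℝ → ℂ)

/-- An admissible quantization of type (i)′ with parameter ν of a Lie subalgebra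
`O ⊆ P` containing the basic set. -/
structure IsQuant (O : Submodule ℝ (ℝ × ℝ → ℝ)) (ν : ℝ)
    (Q : O →ₗ[ℝ] (Dom →ₗ[ℂ] Dom)) : Prop where
  map_bracket : ∀ (f g : O) (h : pb f g ∈ O),
    Q ⟨pb f g, h⟩ = Complex.I • (Q f ∘ₗ Q g - Q g ∘ₗ Q f)
  map_one : ∀ h : fone ∈ O, Q ⟨fone, h⟩ = LinearMap.id
  symm : ∀ f : O, SymmetricOp (Q f)
  map_ell : ∀ (h : fell ∈ O) (ψ : Dom) (t : ℝ),
    (Q ⟨fell, h⟩ ψ : ℝ → ℂ) t = -Complex.I * deriv (ψ : ℝ → ℂ) t + (ν : ℂ) * (ψ : ℝ → ℂ) t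
  map_sin : ∀ (h : fsin ∈ O) (ψ : Dom) (t : ℝ),
    (Q ⟨fsin, h⟩ ψ : ℝ → ℂ) t = (Real.sin t : ℂ) * (ψ : ℝ → ℂ) t
  map_cos : ∀ (h : fcos ∈ O) (ψ : Dom) (t : ℝ),
    (Q ⟨fcos, h⟩ ψ : ℝ → ℂ) t = (Real.cos t : ℂ) * (ψ : ℝ → ℂ) t

end
noncomputable section
/-- `ℓ sin θ` -/
def fellsin : ℝ × ℝ → ℝ := fun p => p.2 * Real.sin p.1
/-- `ℓ cos θ` -/
def fellcos : ℝ × ℝ → ℝ := fun p => p.2 * Real.cos p.1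

lemma fellsin_mem_P : fellsin ∈ P :=
  Submodule.subset_span ⟨1, 1, Or.inl (by funext p; simp [fellsin])⟩
lemma fellcos_mem_P : fellcos ∈ P :=
  Submodule.subset_span ⟨1, 1, Or.inr (by funext p; simp [fellcos])⟩


lemma alg_core {R : Type*} [Ring R] (h2 : ∀ x : R, x + x = 0 → x = 0)
    (S C L A B H U V W : R)
    (hSC : S * C = C * S) (h1 : S * S + C * C = 1)
    (hLS : L * S - S * L = C) (hLC : L * C - C * L = -S)
    (hAS : A * S - S * A = U) (hAC : A * C - C * A = -V)
    (hBS : B * S - S * B = W) (hBC : B * C - C * B = -U)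
    (hVW : V + W = 1)
    (hUS : U * S = S * U) (hUC : U * C = C * U)
    (hVS : V * S = S * V) (hVC : V * C = C * V)
    (hLA : L * A - A * L = B) (hLB : L * B - B * L = -A)
    (hAB : A * B - B * A = -L)
    (hHS : H * S - S * H = -(B + B)) (hHC : H * C - C * H = A + A) :
    A + A = S * L + S * L + C ∧ B + B = C * L + C * L - S := by
  have hW : W = 1 - V := by rw [← hVW]; abel
  subst hW
  have comm : ∀ T : R, (T * S - S * T) * S + S * (T * S - S * T) +
      ((T * C - C * T) * C + C * (T * C - C * T)) = 0 := by
    intro T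
    have : T * (S * S + C * C) - (S * S + C * C) * T = 0 := by rw [h1]; simp
    rw [← this]; noncomm_ring
  have e1 : U * S = V * C := by
    have := comm A
    rw [hAS, hAC, ← hUS, mul_neg, ← hVC] at this
    apply sub_eq_zero.1; apply h2; rw [← this]; noncomm_ring
  have e2 : S - V * S = U * C := by
    have := comm B
    rw [hBS, hBC, mul_neg, ← hUC, mul_sub, ← hVS] at this
    apply sub_eq_zero.1; apply h2; rw [← this]; noncomm_ring
  have eU : U = S * C := by
    calc U = U * (S * S + C * C) := by rw [h1, mul_one]
      _ = (U * S) * S + (U * C) * C := by noncomm_ring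
      _ = (V * C) * S + (S - V * S) * C := by rw [e1, e2]
      _ = V * (C * S - S * C) + S * C := by noncomm_ring
      _ = S * C := by rw [hSC]; simp
  have eV : V = S * S := by
    calc V = V * (S * S + C * C) := by rw [h1, mul_one]
      _ = V * S * S + (V * C) * C := by noncomm_ring
      _ = V * S * S + U * (S * C) := by rw [← e1]; noncomm_ring
      _ = V * S * S + (U * C) * S := by rw [hSC]; noncomm_ring
      _ = S * S := by rw [← e2]; noncomm_ring
  subst eU eV
  have hCC : C * C = 1 - S * S := by rw [← h1]; abel
  -- deviations
  obtain ⟨a, ha⟩ : ∃ a, a = A + A - S * L - S * L - C := ⟨_, rfl⟩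
  obtain ⟨b, hb⟩ : ∃ b, b = B + B - C * L - C * L + S := ⟨_, rfl⟩
  have aS : a * S = S * a := by
    subst ha; linear_combination (norm := noncomm_ring) 2 * hAS - 2 * S * hLS + hSC
  have aC : a * C = C * a := by
    subst ha; linear_combination (norm := noncomm_ring) 2 * hAC - 2 * S * hLC - 2 * hSC * L
  have bS : b * S = S * b := by
    subst hb; linear_combination (norm := noncomm_ring) 2 * hBS - 2 * C * hLS + 2 * hSC * L - 2 * h1
  have bC : b * C = C * b := by
    subst hb; linear_combination (norm := noncomm_ring) 2 * hBC - 2 * C * hLC - hSC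
  have La : L * a - a * L = b := by
    subst ha hb; linear_combination (norm := noncomm_ring) 2 * hLA - 2 * hLS * L - hLC
  have Lb : L * b - b * L = -a := by
    subst ha hb; linear_combination (norm := noncomm_ring) 2 * hLB - 2 * hLC * L + hLS
  have e3 : b * S = a * C := by
    have := comm H
    rw [hHS, hHC] at this
    apply sub_eq_zero.1; apply h2
    subst ha hb
    linear_combination (norm := noncomm_ring) -this + bS - aC - 2 * C * hLS + 2 * S * hLC
  obtain ⟨n, hn⟩ : ∃ n, n = a * S + b * C := ⟨_, rfl⟩
  have an : a = n * S := by
    calc a = a * (S * S + C * C) := by rw [h1, mul_one]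
      _ = a * S * S + (a * C) * C := by noncomm_ring
      _ = a * S * S + b * (S * C) := by rw [← e3]; noncomm_ring
      _ = n * S := by rw [hSC, hn]; noncomm_ring
  have bn : b = n * C := by
    calc b = b * (S * S + C * C) := by rw [h1, mul_one]
      _ = (b * S) * S + b * C * C := by noncomm_ring
      _ = a * (C * S) + b * C * C := by rw [e3]; noncomm_ring
      _ = n * C := by rw [← hSC, hn]; noncomm_ring
  have nS : n * S = S * n := by
    subst hn; linear_combination (norm := noncomm_ring) aS * S - b * hSC + bS * C
  have nC : n * C = C * n := by
    subst hn; linear_combination (norm := noncomm_ring) a * hSC + aC * S + bC * C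
  have ab : a * b = b * a := by
    rw [an, bn]
    calc n * S * (n * C) = n * (S * n) * C := by noncomm_ring
      _ = n * n * (S * C) := by rw [← nS]; noncomm_ring
      _ = n * (n * C) * S := by rw [hSC]; noncomm_ring
      _ = n * C * (n * S) := by linear_combination (norm := noncomm_ring) n * nC * S
  have n0 : n + n = 0 := by
    have k0 : (a + 2 * S * L + C) * (b + 2 * C * L - S)
        - (b + 2 * C * L - S) * (a + 2 * S * L + C) = -4 * L := by
      have p1 : a + 2 * S * L + C = 2 * A := by rw [ha]; noncomm_ring
      have p2 : b + 2 * C * L - S = 2 * B := by rw [hb]; noncomm_ring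
      rw [p1, p2]
      linear_combination (norm := noncomm_ring) 4 * hAB
    have k1 : a * (2 * C * L - S) - (2 * C * L - S) * a = -2 * C * b := by
      linear_combination (norm := noncomm_ring) 2 * aC * L - 2 * C * La - aS
    have k2 : (2 * S * L + C) * b - b * (2 * S * L + C) = -2 * S * a := by
      linear_combination (norm := noncomm_ring) 2 * S * Lb - 2 * bS * L - bC
    have k3 : (2 * S * L + C) * (2 * C * L - S) - (2 * C * L - S) * (2 * S * L + C)
        = -4 * L := by
      linear_combination (norm := noncomm_ring) 4 * S * hLC * L - 4 * C * hLS * L + 4 * hSC * L * L - 4 * h1 * L - 2 * S * hLS - 2 * C * hLC - hSC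
    linear_combination (norm := noncomm_ring) 2 * hn + 2 * aS + 2 * bC - (k0 - ab - k1 - k2 - k3)
  have n0 := h2 n n0
  rw [n0, zero_mul] at an bn
  constructor
  · linear_combination (norm := noncomm_ring) an - ha
  · linear_combination (norm := noncomm_ring) bn - hb


lemma fsc_mem : (fun p : ℝ × ℝ => Real.sin p.1 * Real.cos p.1) ∈ P := by
  have h : (fun p : ℝ × ℝ => p.2 ^ 0 * Real.sin ((2 : ℕ) * p.1)) ∈ P :=
    Submodule.subset_span ⟨0, 2, Or.inl rfl⟩
  have := P.smul_mem (1 / 2 : ℝ) h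
  convert this using 1
  funext p
  simp [Real.sin_two_mul]; ring

lemma fcc_mem : (fun p : ℝ × ℝ => Real.cos p.1 * Real.cos p.1) ∈ P := by
  have h : (fun p : ℝ × ℝ => p.2 ^ 0 * Real.cos ((2 : ℕ) * p.1)) ∈ P :=
    Submodule.subset_span ⟨0, 2, Or.inr rfl⟩
  have := P.smul_mem (1 / 2 : ℝ) (P.add_mem fone_mem_P h)
  convert this using 1
  funext p
  simp [Real.cos_two_mul, fone]; ring

lemma fss_mem : (fun p : ℝ × ℝ => Real.sin p.1 * Real.sin p.1) ∈ P := by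
  have := P.sub_mem fone_mem_P fcc_mem
  convert this using 1
  funext p
  have := Real.sin_sq_add_cos_sq p.1
  simp [fone]; linarith

lemma fll_mem : (fun p : ℝ × ℝ => p.2 ^ 2) ∈ P :=
  Submodule.subset_span ⟨2, 0, Or.inr (by funext p; simp)⟩

lemma quant_br {ν : ℝ} {Q : P →ₗ[ℝ] (Dom →ₗ[ℂ] Dom)} (hQ : IsQuant P ν Q)
    (f g k : P) (c : ℝ) (h : pb f g = c • (k : ℝ × ℝ → ℝ)) :
    (Q f : Module.End ℂ Dom) * Q g - Q g * Q f = (-Complex.I * c) • (Q k : Module.End ℂ Dom) := by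
  have hm : pb f g ∈ P := by rw [h]; exact P.smul_mem c k.2
  have h1 := hQ.map_bracket f g hm
  have h2 : (⟨pb f g, hm⟩ : P) = c • k := Subtype.ext h
  rw [h2, map_smul] at h1
  have h3 : (Complex.I • ((Q f : Module.End ℂ Dom) * Q g - Q g * Q f)) = (c : ℂ) • (Q k : Module.End ℂ Dom) := by
    refine h1.symm.trans ?_
    ext x t
    simp
  rw [mul_smul, ← h3, smul_smul]
  simp

lemma smul_comm1 {R : Type*} [Ring R] [Algebra ℂ R] (X Y : R) :
    (Complex.I • X) * Y - Y * (Complex.I • X) = Complex.I • (X * Y - Y * X) := by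
  rw [smul_mul_assoc, mul_smul_comm, smul_sub]

lemma smul_comm2 {R : Type*} [Ring R] [Algebra ℂ R] (X Y : R) :
    (Complex.I • X) * (Complex.I • Y) - (Complex.I • Y) * (Complex.I • X)
      = Complex.I • Complex.I • (X * Y - Y * X) := by
  rw [smul_comm1, mul_smul_comm, smul_mul_assoc, smul_sub, smul_sub, smul_sub]

lemma alg_core2 {R : Type*} [Ring R] [Algebra ℂ R]
    (S C L A B H U V W : R) (h1 : S * S + C * C = 1) (hVW : V + W = 1)
    (bSC : S * C - C * S = (-Complex.I * (0 : ℝ)) • C)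
    (bUS : U * S - S * U = (-Complex.I * (0 : ℝ)) • C)
    (bUC : U * C - C * U = (-Complex.I * (0 : ℝ)) • C)
    (bVS : V * S - S * V = (-Complex.I * (0 : ℝ)) • C)
    (bVC : V * C - C * V = (-Complex.I * (0 : ℝ)) • C)
    (bLS : L * S - S * L = (-Complex.I * (1 : ℝ)) • C)
    (bLC : L * C - C * L = (-Complex.I * (-1 : ℝ)) • S)
    (bAS : A * S - S * A = (-Complex.I * (1 : ℝ)) • U)
    (bAC : A * C - C * A = (-Complex.I * (-1 : ℝ)) • V)
    (bBS : B * S - S * B = (-Complex.I * (1 : ℝ)) • W)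
    (bBC : B * C - C * B = (-Complex.I * (-1 : ℝ)) • U)
    (bLA : L * A - A * L = (-Complex.I * (1 : ℝ)) • B)
    (bLB : L * B - B * L = (-Complex.I * (-1 : ℝ)) • A)
    (bAB : A * B - B * A = (-Complex.I * (-1 : ℝ)) • L)
    (bHS : H * S - S * H = (-Complex.I * (2 : ℝ)) • B)
    (bHC : H * C - C * H = (-Complex.I * (-2 : ℝ)) • A) :
    A = S * L - (Complex.I / 2) • C ∧ B = C * L + (Complex.I / 2) • S := by
  have key := alg_core (R := R)
    (fun x hx => by
      have h : (2 : ℂ) • x = 0 := by rw [two_smul]; exact hx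
      exact (smul_eq_zero.1 h).resolve_left two_ne_zero)
    S C (Complex.I • L) (Complex.I • A) (Complex.I • B) H U V W
    (by simpa [sub_eq_zero] using bSC) h1
    (by rw [smul_comm1, bLS, smul_smul]; simp)
    (by rw [smul_comm1, bLC, smul_smul]; simp)
    (by rw [smul_comm1, bAS, smul_smul]; simp)
    (by rw [smul_comm1, bAC, smul_smul]; simp)
    (by rw [smul_comm1, bBS, smul_smul]; simp)
    (by rw [smul_comm1, bBC, smul_smul]; simp) hVW
    (by simpa [sub_eq_zero] using bUS) (by simpa [sub_eq_zero] using bUC)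
    (by simpa [sub_eq_zero] using bVS) (by simpa [sub_eq_zero] using bVC)
    (by rw [smul_comm2, bLA, smul_smul, smul_smul]; simp)
    (by rw [smul_comm2, bLB, smul_smul, smul_smul]; simp)
    (by rw [smul_comm2, bAB, smul_smul, smul_smul]; simp)
    (by rw [bHS, ← two_smul ℂ, smul_smul, ← neg_smul]; congr 1; push_cast; ring)
    (by rw [bHC, ← two_smul ℂ, smul_smul]; congr 1; push_cast; ring)
  have hI : ∀ X Y : R, Complex.I • X + Complex.I • X = Y →
      X = (-Complex.I / 2) • Y := by
    intro X Y h
    rw [← h, ← two_smul ℂ, smul_smul, smul_smul]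
    have : -Complex.I / 2 * (2 * Complex.I) = 1 := by
      linear_combination -Complex.I_mul_I
    simp only [mul_assoc] at *
    rw [this, one_smul]
  constructor
  · rw [hI _ _ key.1, mul_smul_comm, smul_add, smul_add, smul_smul, ← add_smul, sub_eq_add_neg,
      ← neg_smul, ← neg_div]
    congr 1
    rw [show -Complex.I / 2 * Complex.I + -Complex.I / 2 * Complex.I = 1 by
      linear_combination -Complex.I_mul_I, one_smul]
  · rw [hI _ _ key.2, mul_smul_comm, smul_sub, smul_add, smul_smul, ← add_smul, sub_eq_add_neg,
      ← neg_smul, neg_div, neg_neg]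
    congr 1
    rw [show -(Complex.I / 2) * Complex.I + -(Complex.I / 2) * Complex.I = 1 by
      linear_combination -Complex.I_mul_I, one_smul]

set_option linter.unusedSimpArgs false in
theorem stmt1 (ν : ℝ) (Q : P →ₗ[ℝ] (Dom →ₗ[ℂ] Dom)) (hQ : IsQuant P ν Q) :
    Q ⟨fellsin, fellsin_mem_P⟩ =
        Q ⟨fsin, fsin_mem_P⟩ ∘ₗ Q ⟨fell, fell_mem_P⟩ - (Complex.I / 2) • Q ⟨fcos, fcos_mem_P⟩ ∧
      Q ⟨fellcos, fellcos_mem_P⟩ =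
        Q ⟨fcos, fcos_mem_P⟩ ∘ₗ Q ⟨fell, fell_mem_P⟩ + (Complex.I / 2) • Q ⟨fsin, fsin_mem_P⟩ := by
  have hfun : ∀ x y : Dom, (∀ t, (x : ℝ → ℂ) t = (y : ℝ → ℂ) t) → x = y :=
    fun x y h => Subtype.ext (funext h)
  obtain ⟨S, hS⟩ : ∃ S : Module.End ℂ Dom, S = Q ⟨fsin, fsin_mem_P⟩ := ⟨_, rfl⟩
  obtain ⟨C, hC⟩ : ∃ S : Module.End ℂ Dom, S = Q ⟨fcos, fcos_mem_P⟩ := ⟨_, rfl⟩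
  obtain ⟨L, hL⟩ : ∃ S : Module.End ℂ Dom, S = Q ⟨fell, fell_mem_P⟩ := ⟨_, rfl⟩
  obtain ⟨A, hA⟩ : ∃ S : Module.End ℂ Dom, S = Q ⟨fellsin, fellsin_mem_P⟩ := ⟨_, rfl⟩
  obtain ⟨B, hB⟩ : ∃ S : Module.End ℂ Dom, S = Q ⟨fellcos, fellcos_mem_P⟩ := ⟨_, rfl⟩
  obtain ⟨H, hH⟩ : ∃ S : Module.End ℂ Dom, S = Q ⟨_, fll_mem⟩ := ⟨_, rfl⟩
  obtain ⟨U, hU⟩ : ∃ S : Module.End ℂ Dom, S = Q ⟨_, fsc_mem⟩ := ⟨_, rfl⟩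
  obtain ⟨V, hV⟩ : ∃ S : Module.End ℂ Dom, S = Q ⟨_, fss_mem⟩ := ⟨_, rfl⟩
  obtain ⟨W, hW⟩ : ∃ S : Module.End ℂ Dom, S = Q ⟨_, fcc_mem⟩ := ⟨_, rfl⟩
  have h1 : S * S + C * C = 1 := by
    apply LinearMap.ext; intro x; apply hfun; intro t
    have := Complex.sin_sq_add_cos_sq (t : ℂ)
    simp [hS, hC, hQ.map_sin, hQ.map_cos]
    linear_combination ((x : ℝ → ℂ) t) * this
  have hVW : V + W = 1 := by
    have h := hQ.map_one fone_mem_P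
    rw [hV, hW]
    refine Eq.trans ?_ h
    rw [← map_add]
    congr 1
    apply Subtype.ext
    funext p
    have := Real.sin_sq_add_cos_sq p.1
    simp [fone]; linarith
  have bSC : S * C - C * S = (-Complex.I * (0 : ℝ)) • C := by
    rw [hS, hC]; apply quant_br hQ; (funext p; simp [pb, pdEll, pdTheta, fsin, fcos, fell, fellsin, fellcos]; try nlinarith [Real.sin_sq_add_cos_sq p.1])
  have bUS : U * S - S * U = (-Complex.I * (0 : ℝ)) • C := by
    rw [hS, hU, hC]; apply quant_br hQ; (funext p; simp [pb, pdEll, pdTheta, fsin, fcos, fell, fellsin, fellcos]; try nlinarith [Real.sin_sq_add_cos_sq p.1])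
  have bUC : U * C - C * U = (-Complex.I * (0 : ℝ)) • C := by
    rw [hU, hC]; apply quant_br hQ; (funext p; simp [pb, pdEll, pdTheta, fsin, fcos, fell, fellsin, fellcos]; try nlinarith [Real.sin_sq_add_cos_sq p.1])
  have bVS : V * S - S * V = (-Complex.I * (0 : ℝ)) • C := by
    rw [hS, hV, hC]; apply quant_br hQ; (funext p; simp [pb, pdEll, pdTheta, fsin, fcos, fell, fellsin, fellcos]; try nlinarith [Real.sin_sq_add_cos_sq p.1])
  have bVC : V * C - C * V = (-Complex.I * (0 : ℝ)) • C := by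
    rw [hV, hC]; apply quant_br hQ; (funext p; simp [pb, pdEll, pdTheta, fsin, fcos, fell, fellsin, fellcos]; try nlinarith [Real.sin_sq_add_cos_sq p.1])
  have bLS : L * S - S * L = (-Complex.I * (1 : ℝ)) • C := by
    rw [hL, hS, hC]; apply quant_br hQ; (funext p; simp [pb, pdEll, pdTheta, fsin, fcos, fell, fellsin, fellcos]; try nlinarith [Real.sin_sq_add_cos_sq p.1])
  have bLC : L * C - C * L = (-Complex.I * (-1 : ℝ)) • S := by
    rw [hL, hS, hC]; apply quant_br hQ; (funext p; simp [pb, pdEll, pdTheta, fsin, fcos, fell, fellsin, fellcos]; try nlinarith [Real.sin_sq_add_cos_sq p.1])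
  have bAS : A * S - S * A = (-Complex.I * (1 : ℝ)) • U := by
    rw [hA, hS, hU]; apply quant_br hQ; (funext p; simp [pb, pdEll, pdTheta, fsin, fcos, fell, fellsin, fellcos]; try nlinarith [Real.sin_sq_add_cos_sq p.1])
  have bAC : A * C - C * A = (-Complex.I * (-1 : ℝ)) • V := by
    rw [hA, hC, hV]; apply quant_br hQ; (funext p; simp [pb, pdEll, pdTheta, fsin, fcos, fell, fellsin, fellcos]; try nlinarith [Real.sin_sq_add_cos_sq p.1])
  have bBS : B * S - S * B = (-Complex.I * (1 : ℝ)) • W := by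
    rw [hB, hS, hW]; apply quant_br hQ; (funext p; simp [pb, pdEll, pdTheta, fsin, fcos, fell, fellsin, fellcos]; try nlinarith [Real.sin_sq_add_cos_sq p.1])
  have bBC : B * C - C * B = (-Complex.I * (-1 : ℝ)) • U := by
    rw [hB, hC, hU]; apply quant_br hQ; (funext p; simp [pb, pdEll, pdTheta, fsin, fcos, fell, fellsin, fellcos]; try nlinarith [Real.sin_sq_add_cos_sq p.1])
  have bLA : L * A - A * L = (-Complex.I * (1 : ℝ)) • B := by
    rw [hL, hA, hB]; apply quant_br hQ; (funext p; simp [pb, pdEll, pdTheta, fsin, fcos, fell, fellsin, fellcos]; try nlinarith [Real.sin_sq_add_cos_sq p.1])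
  have bLB : L * B - B * L = (-Complex.I * (-1 : ℝ)) • A := by
    rw [hL, hA, hB]; apply quant_br hQ; (funext p; simp [pb, pdEll, pdTheta, fsin, fcos, fell, fellsin, fellcos]; try nlinarith [Real.sin_sq_add_cos_sq p.1])
  have bAB : A * B - B * A = (-Complex.I * (-1 : ℝ)) • L := by
    rw [hL, hA, hB]; apply quant_br hQ; (funext p; simp [pb, pdEll, pdTheta, fsin, fcos, fell, fellsin, fellcos]; linear_combination (-p.2) * Real.sin_sq_add_cos_sq p.1)
  have bHS : H * S - S * H = (-Complex.I * (2 : ℝ)) • B := by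
    rw [hH, hS, hB]; apply quant_br hQ; (funext p; simp [pb, pdEll, pdTheta, fsin, fcos, fell, fellsin, fellcos]; try nlinarith [Real.sin_sq_add_cos_sq p.1])
  have bHC : H * C - C * H = (-Complex.I * (-2 : ℝ)) • A := by
    rw [hH, hC, hA]; apply quant_br hQ; (funext p; simp [pb, pdEll, pdTheta, fsin, fcos, fell, fellsin, fellcos]; try nlinarith [Real.sin_sq_add_cos_sq p.1])
  rw [← hS, ← hC, ← hL, ← hA, ← hB]
  exact alg_core2 S C L A B H U V W h1 hVW bSC bUS bUC bVS bVC bLS bLC bAS bAC bBS bBC bLA bLB bAB bHS bHC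
end
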